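/- For every fixed positive integer M₁ there exist constants c > 0 and C ≥ 0 such that the following holds for all integers n ≥ 2 and all positive integers γ: in the model where M₁·n messages are each sent to an independently and uniformly chosen bin among n bins, and X_m denotes the number of bins receiving exactly m messages, one has P( Σ_{m=0}^{M₁·n} |X_m − E[X_m]| > γ³·√n ) ≤ exp(−c·γ² + C·log n). -/

import Mathlib

open Finset
open scoped Classical
open scoped BigOperators

theorem expect_exp_sub_expect_le {α : Type*} [Fintype α] [Nonempty α] (g : α → ℝ) {K : ℝ}
    (hg : ∀ a b, |g a - g b| ≤ K) :
    𝔼 a, Real.exp (g a - 𝔼 b, g b) ≤ Real.exp (K ^ 2 / 2) := by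
  set μ := 𝔼 b, g b with hμ
  have one_le : 1 ≤ 𝔼 b, Real.exp (-(g b - μ)) := by
    have h : 𝔼 b, (-(g b - μ) + 1) ≤ 𝔼 b, Real.exp (-(g b - μ)) :=
      expect_le_expect fun b _ => Real.add_one_le_exp _
    rwa [expect_add_distrib, expect_neg_distrib, expect_sub_distrib, Fintype.expect_const,
      Fintype.expect_const, ← hμ, sub_self, neg_zero, zero_add] at h
  have hprod : (𝔼 a, Real.exp (g a - μ)) * 𝔼 b, Real.exp (-(g b - μ))
      = 𝔼 a, 𝔼 b, Real.exp (g a - g b) := by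
    rw [Fintype.expect_mul_expect]
    refine expect_congr rfl fun a _ => expect_congr rfl fun b _ => ?_
    rw [← Real.exp_add]
    congr 1
    ring
  have hswap : 𝔼 a, 𝔼 b, Real.exp (g a - g b) = 𝔼 a, 𝔼 b, Real.exp (-(g a - g b)) := by
    rw [expect_comm]
    simp only [neg_sub]
  have hcosh : 𝔼 a, 𝔼 b, Real.exp (g a - g b) = 𝔼 a, 𝔼 b, Real.cosh (g a - g b) := by
    simp only [Real.cosh_eq, ← expect_div, expect_add_distrib]
    rw [← hswap]
    ring
  calc 𝔼 a, Real.exp (g a - μ)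
      ≤ (𝔼 a, Real.exp (g a - μ)) * 𝔼 b, Real.exp (-(g b - μ)) :=
        le_mul_of_one_le_right (expect_nonneg fun _ _ => (Real.exp_pos _).le) one_le
    _ = 𝔼 a, 𝔼 b, Real.cosh (g a - g b) := by rw [hprod, hcosh]
    _ ≤ Real.exp (K ^ 2 / 2) := by
        refine expect_le univ_nonempty fun a _ => expect_le univ_nonempty fun b _ => ?_
        refine (Real.cosh_le_exp_half_sq _).trans (Real.exp_le_exp.2 ?_)
        have := sq_le_sq' (abs_le.1 (hg a b)).1 (abs_le.1 (hg a b)).2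
        linarith

theorem Fin.expect_cons {α : Type*} [Fintype α] {N : ℕ} (F : (Fin (N + 1) → α) → ℝ) :
    𝔼 ω, F ω = 𝔼 a, 𝔼 x : Fin N → α, F (Fin.cons a x) := by
  rw [← Fintype.expect_equiv (Fin.consEquiv fun _ : Fin (N + 1) => α)
    (fun p => F (Fin.cons p.1 p.2)) F fun _ => rfl]
  exact expect_product' univ univ fun a x => F (Fin.cons a x)

/-- The moment generating function bound behind McDiarmid's inequality. -/
theorem expect_exp_sub_expect_le_of_boundedDiff {α : Type*} [Fintype α] [Nonempty α] {K : ℝ} :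
    ∀ {N : ℕ} (f : (Fin N → α) → ℝ), (∀ ω i a, |f (Function.update ω i a) - f ω| ≤ K) →
      𝔼 ω, Real.exp (f ω - 𝔼 ω', f ω') ≤ Real.exp (N * (K ^ 2 / 2))
  | 0, f, _ => by
    refine expect_le univ_nonempty fun ω _ => ?_
    have h : 𝔼 ω', f ω' = f ω := by
      rw [← Fintype.expect_const (ι := Fin 0 → α) (f ω)]
      exact expect_congr rfl fun ω' _ => by rw [Subsingleton.elim ω' ω]
    rw [h, sub_self, Nat.cast_zero, zero_mul]
  | N + 1, f, hf => by
    set g : α → ℝ := fun a => 𝔼 x : Fin N → α, f (Fin.cons a x) with hg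
    have hmean : 𝔼 ω, f ω = 𝔼 a, g a := Fin.expect_cons f
    have hfiber (a : α) : 𝔼 x : Fin N → α, Real.exp (f (Fin.cons a x) - g a)
        ≤ Real.exp (N * (K ^ 2 / 2)) := by
      refine expect_exp_sub_expect_le_of_boundedDiff (fun x => f (Fin.cons a x)) fun x i b => ?_
      simpa only [Fin.cons_update] using hf (Fin.cons a x) i.succ b
    have hgdiff (a b : α) : |g a - g b| ≤ K := by
      rw [hg]
      simp only
      rw [← expect_sub_distrib]
      refine (abs_expect_le _ _).trans (expect_le univ_nonempty fun x _ => ?_)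
      simpa only [Fin.update_cons_zero] using hf (Fin.cons b x) 0 a
    calc 𝔼 ω, Real.exp (f ω - 𝔼 ω', f ω')
        = 𝔼 a, Real.exp (g a - 𝔼 b, g b) *
            𝔼 x : Fin N → α, Real.exp (f (Fin.cons a x) - g a) := by
          rw [Fin.expect_cons, hmean]
          refine expect_congr rfl fun a _ => ?_
          rw [mul_expect]
          refine expect_congr rfl fun x _ => ?_
          rw [← Real.exp_add]
          congr 1
          ring
      _ ≤ 𝔼 a, Real.exp (g a - 𝔼 b, g b) * Real.exp (N * (K ^ 2 / 2)) :=
          expect_le_expect fun a _ => mul_le_mul_of_nonneg_left (hfiber a) (Real.exp_pos _).le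
      _ ≤ Real.exp (K ^ 2 / 2) * Real.exp (N * (K ^ 2 / 2)) := by
          rw [← expect_mul]
          exact mul_le_mul_of_nonneg_right (expect_exp_sub_expect_le g hgdiff) (Real.exp_pos _).le
      _ = Real.exp ((N + 1 : ℕ) * (K ^ 2 / 2)) := by
          rw [← Real.exp_add]
          congr 1
          push_cast
          ring

/-- The number of messages received by the bin `b`. -/
def load {N n : ℕ} (ω : Fin N → Fin n) (b : Fin n) : ℕ :=
  (univ.filter fun i => ω i = b).card

/-- The number of bins receiving exactly `m` messages. -/
def binCount {N n : ℕ} (m : ℕ) (ω : Fin N → Fin n) : ℕ :=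
  (univ.filter fun b => load ω b = m).card

theorem load_update_of_ne {N n : ℕ} (ω : Fin N → Fin n) (i : Fin N) {a b : Fin n}
    (ha : b ≠ a) (hb : b ≠ ω i) : load (Function.update ω i a) b = load ω b := by
  unfold load
  congr 1
  ext j
  by_cases hj : j = i
  · subst hj
    simp [ha.symm, hb.symm]
  · simp [hj]

theorem abs_binCount_update_sub_le {N n : ℕ} (m : ℕ) (ω : Fin N → Fin n) (i : Fin N)
    (a : Fin n) : |(binCount m (Function.update ω i a) : ℝ) - binCount m ω| ≤ 2 := by
  have key (A B : Finset (Fin n)) (h : ∀ b, b ≠ a → b ≠ ω i → b ∈ A → b ∈ B) :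
      A.card ≤ B.card + 2 := by
    calc A.card ≤ (B ∪ {a, ω i}).card := card_le_card fun b hb => by
          simp only [mem_union, mem_insert, mem_singleton]
          by_cases h₁ : b = a
          · exact .inr (.inl h₁)
          · by_cases h₂ : b = ω i
            · exact .inr (.inr h₂)
            · exact .inl (h b h₁ h₂ hb)
      _ ≤ B.card + 2 := (card_union_le _ _).trans (Nat.add_le_add_left card_le_two _)
  have h₁ : binCount m (Function.update ω i a) ≤ binCount m ω + 2 :=
    key _ _ fun b ha hb => by simp [load_update_of_ne ω i ha hb]
  have h₂ : binCount m ω ≤ binCount m (Function.update ω i a) + 2 :=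
    key _ _ fun b ha hb => by simp [load_update_of_ne ω i ha hb]
  rw [abs_le]
  constructor <;> [have h := h₂; have h := h₁] <;>
  · have : ((_ : ℕ) : ℝ) ≤ ((_ : ℕ) : ℝ) := Nat.cast_le.2 h
    push_cast at this
    linarith

theorem expect_exp_binCount_le {N n : ℕ} [NeZero n] (m : ℕ) (t : ℝ) :
    𝔼 ω : Fin N → Fin n, Real.exp (t * (binCount m ω - 𝔼 ω' : Fin N → Fin n, (binCount m ω' : ℝ)))
      ≤ Real.exp (N * (2 * t ^ 2)) := by
  have h := expect_exp_sub_expect_le_of_boundedDiff (K := 2 * |t|)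
    (fun ω : Fin N → Fin n => t * (binCount m ω : ℝ)) fun ω i a => by
      rw [← mul_sub, abs_mul, mul_comm]
      exact mul_le_mul_of_nonneg_right (abs_binCount_update_sub_le m ω i a) (abs_nonneg t)
  rw [← mul_expect, mul_pow, sq_abs] at h
  simp only [← mul_sub] at h
  convert h using 3
  ring

theorem expect_exp_load_le {M n : ℕ} [NeZero n] (b : Fin n) :
    𝔼 ω : Fin (M * n) → Fin n, Real.exp (load ω b) ≤ Real.exp (2 * M) := by
  have hn : (0 : ℝ) < n := Nat.cast_pos.2 (NeZero.pos n)
  have hprod (ω : Fin (M * n) → Fin n) :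
      Real.exp (load ω b) = ∏ i, if ω i = b then Real.exp 1 else 1 := by
    rw [prod_ite, prod_const, prod_const_one, mul_one, ← Real.exp_nat_mul, mul_one, load]
  have hmean : 𝔼 c : Fin n, (if c = b then Real.exp 1 else 1) ≤ Real.exp (2 / n) := by
    rw [Fintype.expect_eq_sum_div_card, Fintype.card_fin]
    have hsum : ∑ c : Fin n, (if c = b then Real.exp 1 else 1) = n + (Real.exp 1 - 1) := by
      have (c : Fin n) : (if c = b then Real.exp 1 else 1)
          = 1 + if c = b then Real.exp 1 - 1 else 0 := by split_ifs <;> ring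
      simp [this, sum_add_distrib]
    rw [hsum, add_div, div_self hn.ne', add_comm]
    refine le_trans ?_ (Real.add_one_le_exp _)
    have := Real.exp_one_lt_d9
    gcongr
    linarith
  calc 𝔼 ω : Fin (M * n) → Fin n, Real.exp (load ω b)
      = (𝔼 c : Fin n, (if c = b then Real.exp 1 else 1)) ^ (M * n) := by
        rw [expect_pow, Fintype.piFinset_univ]
        exact expect_congr rfl fun ω _ => hprod ω
    _ ≤ Real.exp (2 / n) ^ (M * n) := by
        refine pow_le_pow_left₀ (expect_nonneg fun c _ => ?_) hmean _
        split_ifs <;> positivity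
    _ = Real.exp (2 * M) := by
        rw [← Real.exp_nat_mul]
        congr 1
        push_cast
        field_simp

theorem expect_sum_binCount_le {M n : ℕ} [NeZero n] (L : ℕ) (s : Finset ℕ)
    (hs : ∀ m ∈ s, L ≤ m) :
    𝔼 ω : Fin (M * n) → Fin n, ∑ m ∈ s, (binCount m ω : ℝ) ≤ n * Real.exp (2 * M - L) := by
  have hpt (ω : Fin (M * n) → Fin n) :
      ∑ m ∈ s, (binCount m ω : ℝ) ≤ ∑ b, Real.exp (load ω b) * Real.exp (-L) := by
    simp only [binCount, card_filter, Nat.cast_sum, Nat.cast_ite, Nat.cast_one, Nat.cast_zero]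
    rw [sum_comm]
    refine sum_le_sum fun b _ => ?_
    rw [sum_ite_eq, ← Real.exp_add]
    split_ifs with h
    · have : (L : ℝ) ≤ load ω b := Nat.cast_le.2 (hs _ h)
      exact Real.one_le_exp (by linarith)
    · positivity
  calc _ ≤ 𝔼 ω : Fin (M * n) → Fin n, ∑ b, Real.exp (load ω b) * Real.exp (-L) :=
        expect_le_expect fun ω _ => hpt ω
    _ = ∑ b : Fin n, (𝔼 ω : Fin (M * n) → Fin n, Real.exp (load ω b)) * Real.exp (-L) := by
        rw [expect_sum_comm]
        simp only [expect_mul]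
    _ ≤ ∑ _b : Fin n, Real.exp (2 * M) * Real.exp (-L) :=
        sum_le_sum fun b _ =>
          mul_le_mul_of_nonneg_right (expect_exp_load_le b) (Real.exp_pos _).le
    _ = n * Real.exp (2 * M - L) := by
        rw [sum_const, card_univ, Fintype.card_fin, nsmul_eq_mul, ← Real.exp_add, sub_eq_add_neg]

/-- The deviation probability, bounded through a union bound over the occupancies `m < L`. -/
theorem expect_indicator_sum_abs_binCount_sub_le {M n : ℕ} [NeZero n] (L : ℕ) {s t T : ℝ}
    (ht : 0 ≤ t) (hT : L * s + n * Real.exp (2 * M - L) ≤ T) :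
    𝔼 ω : Fin (M * n) → Fin n, (if T < ∑ m ∈ range (M * n + 1),
        |(binCount m ω : ℝ) - 𝔼 ω' : Fin (M * n) → Fin n, (binCount m ω' : ℝ)|
        then (1 : ℝ) else 0)
      ≤ n * Real.exp (2 * M - L) +
        (M * n + 1) * (2 * Real.exp ((M * n : ℕ) * (2 * t ^ 2) - t * s)) := by
  set μ : ℕ → ℝ := fun m => 𝔼 ω : Fin (M * n) → Fin n, (binCount m ω : ℝ) with hμ
  set R := range (M * n + 1)
  set Y : (Fin (M * n) → Fin n) → ℝ :=
    fun ω => ∑ m ∈ R.filter (fun m => ¬ m < L), (binCount m ω : ℝ) with hY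
  set Z : ℕ → (Fin (M * n) → Fin n) → ℝ := fun m ω =>
    Real.exp (-(t * s)) *
      (Real.exp (t * (binCount m ω - μ m)) + Real.exp (-t * (binCount m ω - μ m))) with hZ
  have hYexp : 𝔼 ω, Y ω ≤ n * Real.exp (2 * M - L) :=
    expect_sum_binCount_le L _ fun m hm => not_lt.1 (mem_filter.1 hm).2
  have hZexp (m : ℕ) : 𝔼 ω, Z m ω ≤ 2 * Real.exp ((M * n : ℕ) * (2 * t ^ 2) - t * s) := by
    have h₁ := expect_exp_binCount_le (N := M * n) (n := n) m t
    have h₂ := expect_exp_binCount_le (N := M * n) (n := n) m (-t)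
    rw [neg_sq] at h₂
    rw [hZ, ← mul_expect, expect_add_distrib, sub_eq_add_neg, Real.exp_add]
    nlinarith [Real.exp_pos (-(t * s))]
  have hYnn (ω) : 0 ≤ Y ω := sum_nonneg fun _ _ => Nat.cast_nonneg _
  have hZnn (m ω) : 0 ≤ Z m ω := by positivity
  have hpt (ω) : (if T < ∑ m ∈ R, |(binCount m ω : ℝ) - μ m| then (1 : ℝ) else 0)
      ≤ Y ω + ∑ m ∈ R, Z m ω := by
    have hZsum : 0 ≤ ∑ m ∈ R, Z m ω := sum_nonneg fun m _ => hZnn m ω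
    split_ifs with hbad
    swap
    · linarith [hYnn ω]
    by_cases hY1 : 1 ≤ Y ω
    · linarith
    have hY0 : Y ω = 0 := by
      rw [hY] at hY1 ⊢
      simp only at hY1 ⊢
      rw [← Nat.cast_sum] at hY1 ⊢
      rw [Nat.one_le_cast] at hY1
      rw [Nat.cast_eq_zero]
      omega
    obtain ⟨m, hm, hdev⟩ : ∃ m ∈ R, s ≤ |(binCount m ω : ℝ) - μ m| := by
      by_contra! hsmall
      refine hbad.not_ge (le_trans ?_ hT)
      rw [← sum_filter_add_sum_filter_not R (fun m => m < L)]
      have hs : 0 ≤ s := (abs_nonneg _).trans (hsmall 0 (by simp [R])).le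
      refine add_le_add ?_ ?_
      · calc _ ≤ ∑ m ∈ R.filter (fun m => m < L), s :=
              sum_le_sum fun m hm => (hsmall m (mem_filter.1 hm).1).le
          _ ≤ L * s := by
              rw [sum_const, nsmul_eq_mul]
              refine mul_le_mul_of_nonneg_right (Nat.cast_le.2 ?_) hs
              exact (card_le_card fun m hm => mem_range.2 (mem_filter.1 hm).2).trans_eq
                (card_range L)
      · calc _ ≤ ∑ m ∈ R.filter (fun m => ¬ m < L), ((binCount m ω : ℝ) + μ m) := by
              refine sum_le_sum fun m _ => (abs_sub _ _).trans ?_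
              rw [Nat.abs_cast, abs_of_nonneg (expect_nonneg fun _ _ => Nat.cast_nonneg _)]
          _ = 𝔼 ω, Y ω := by
              rw [sum_add_distrib, expect_sum_comm]
              exact add_eq_right.2 hY0
          _ ≤ _ := hYexp
    have hZm : 1 ≤ Z m ω := by
      have h : 1 ≤ Real.exp (-(t * s)) * Real.exp (t * |(binCount m ω : ℝ) - μ m|) := by
        rw [← Real.exp_add]
        exact Real.one_le_exp (by nlinarith)
      refine h.trans (mul_le_mul_of_nonneg_left ?_ (Real.exp_pos _).le)
      rcases abs_cases ((binCount m ω : ℝ) - μ m) with ⟨h, -⟩ | ⟨h, -⟩ <;> rw [h]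
      · exact le_add_of_nonneg_right (Real.exp_pos _).le
      · rw [neg_mul_comm]
        exact le_add_of_nonneg_left (Real.exp_pos _).le
    have := single_le_sum (fun m _ => hZnn m ω) hm
    linarith [hYnn ω]
  calc _ ≤ 𝔼 ω, (Y ω + ∑ m ∈ R, Z m ω) := expect_le_expect fun ω _ => hpt ω
    _ = 𝔼 ω, Y ω + ∑ m ∈ R, 𝔼 ω, Z m ω := by
      rw [expect_add_distrib, expect_sum_comm univ R fun ω m => Z m ω]
    _ ≤ _ := by
      refine add_le_add hYexp ((sum_le_sum fun m _ => hZexp m).trans_eq ?_)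
      rw [sum_const, card_range, nsmul_eq_mul]
      push_cast
      ring

/-- For every fixed positive integer `M₁` there are constants `c > 0`, `C ≥ 0`
such that for all `n ≥ 2` and positive integers `γ`, in the model where `M₁ * n` messages
are each sent to an independently and uniformly chosen bin among `n` bins (uniform measure
on `Fin (M₁ * n) → Fin n`), the probability that
`∑_{m=0}^{M₁·n} |X_m − E[X_m]| > γ³·√n` is at most `exp(−c·γ² + C·log n)`. -/
theorem stmt0 (M₁ : ℕ) (hM₁ : 0 < M₁) :
    ∃ c C : ℝ, 0 < c ∧ 0 ≤ C ∧
      ∀ n : ℕ, 2 ≤ n → ∀ γ : ℕ, 0 < γ →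
        -- X m ω = number of bins receiving exactly m messages in outcome ω
        (fun (X : ℕ → (Fin (M₁ * n) → Fin n) → ℕ)
             (E : ((Fin (M₁ * n) → Fin n) → ℝ) → ℝ) =>
          ((Finset.univ.filter (fun ω : Fin (M₁ * n) → Fin n =>
              (γ : ℝ) ^ 3 * Real.sqrt n <
                ∑ m ∈ Finset.range (M₁ * n + 1),
                  |(X m ω : ℝ) - E (fun ω' => (X m ω' : ℝ))|)).card : ℝ) /
            (Fintype.card (Fin (M₁ * n) → Fin n) : ℝ)
          ≤ Real.exp (-c * (γ : ℝ) ^ 2 + C * Real.log n))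
        (fun m ω => (Finset.univ.filter (fun b : Fin n =>
            (Finset.univ.filter (fun i : Fin (M₁ * n) => ω i = b)).card = m)).card)
        (fun f => (∑ ω : Fin (M₁ * n) → Fin n, f ω) /
            (Fintype.card (Fin (M₁ * n) → Fin n) : ℝ)) := by
  refine ⟨1 / (32 * M₁), 4 * M₁ + 5, by positivity, by positivity, fun n hn γ hγ => ?_⟩
  have : NeZero n := ⟨by omega⟩
  have hM : (1 : ℝ) ≤ M₁ := Nat.one_le_cast.2 hM₁
  have hn₂ : (2 : ℝ) ≤ n := Nat.ofNat_le_cast.2 hn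
  have hγ₁ : (1 : ℝ) ≤ γ := Nat.one_le_cast.2 hγ
  have hlog : 1 / 2 ≤ Real.log n := by
    have := Real.log_two_gt_d9
    have := Real.log_le_log two_pos hn₂
    linarith
  have hexplog : Real.exp (Real.log n) = n := Real.exp_log (by linarith)
  have hc : 1 / (32 * (M₁ : ℝ)) ≤ 1 := by
    rw [div_le_one (by positivity)]
    linarith
  have hcγ : 1 / (32 * (M₁ : ℝ)) * (γ : ℝ) ^ 2 ≤ (γ : ℝ) ^ 2 :=
    mul_le_of_le_one_left (by positivity) hc
  simp only [← Fintype.expect_eq_sum_div_card]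
  change _ / _ ≤ _
  rw [card_filter, Nat.cast_sum, ← Fintype.expect_eq_sum_div_card]
  simp only [Nat.cast_ite, Nat.cast_one, Nat.cast_zero]
  rcases lt_or_ge ((γ : ℝ) ^ 2) (2 * M₁ + 1 + Real.log n) with hsmall | hlarge
  · refine (expect_le univ_nonempty (a := 1) fun ω _ => by split_ifs <;> norm_num).trans
      (Real.one_le_exp ?_)
    nlinarith
  have htail : n * Real.exp (2 * M₁ - (γ : ℝ) ^ 2) ≤ 1 / 2 := by
    calc n * Real.exp (2 * M₁ - (γ : ℝ) ^ 2)
        ≤ Real.exp (Real.log n) * Real.exp (-1 - Real.log n) := by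
          rw [hexplog]
          exact mul_le_mul_of_nonneg_left (Real.exp_le_exp.2 (by linarith)) (by linarith)
      _ = (Real.exp 1)⁻¹ := by
          rw [← Real.exp_add, ← Real.exp_neg]
          congr 1
          ring
      _ ≤ 1 / 2 := by
          rw [one_div]
          exact inv_anti₀ two_pos (by linarith [Real.exp_one_gt_d9])
  have hsqrt : 1 ≤ Real.sqrt n := Real.one_le_sqrt.2 (by linarith)
  have hsq : Real.sqrt n * Real.sqrt n = n := Real.mul_self_sqrt (by positivity)
  have hbound := expect_indicator_sum_abs_binCount_sub_le (M := M₁) (n := n) (γ ^ 2)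
    (s := γ * Real.sqrt n / 2) (t := γ / (8 * M₁ * Real.sqrt n))
    (T := (γ : ℝ) ^ 3 * Real.sqrt n) (by positivity) (by
      push_cast
      have : 1 ≤ (γ : ℝ) ^ 3 * Real.sqrt n := one_le_mul_of_one_le_of_one_le
        (one_le_pow₀ hγ₁) hsqrt
      linarith)
  refine (le_of_eq_of_le ?_ hbound).trans ?_
  · rfl
  have hexponent : ((M₁ * n : ℕ) : ℝ) * (2 * (γ / (8 * M₁ * Real.sqrt n)) ^ 2)
      - γ / (8 * M₁ * Real.sqrt n) * (γ * Real.sqrt n / 2) = -(1 / (32 * M₁)) * (γ : ℝ) ^ 2 := by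
    push_cast
    rw [div_pow, mul_pow, mul_pow, sq (Real.sqrt n), hsq]
    field_simp
    ring
  rw [hexponent, Real.exp_add]
  set p := Real.exp (-(1 / (32 * M₁)) * (γ : ℝ) ^ 2)
  have hp : 0 < p := Real.exp_pos _
  have hfirst : Real.exp (2 * M₁ - ((γ ^ 2 : ℕ) : ℝ)) ≤ Real.exp (2 * M₁) * p := by
    rw [← Real.exp_add, Real.exp_le_exp]
    push_cast
    linarith
  have hpoly : n * Real.exp (2 * M₁) + 2 * (M₁ * n + 1)
      ≤ Real.exp ((4 * M₁ + 5) * Real.log n) := by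
    have h₁ : 2 * (M₁ : ℝ) + 1 ≤ Real.exp (2 * M₁) := Real.add_one_le_exp _
    have h₂ : (3 : ℝ) ≤ Real.exp 2 := by linarith [Real.add_one_le_exp (2 : ℝ)]
    calc n * Real.exp (2 * M₁) + 2 * (M₁ * n + 1)
        ≤ n * Real.exp (2 * M₁) + n * (2 * M₁ + 1) := by linarith
      _ ≤ n * Real.exp (2 * M₁) + n * Real.exp (2 * M₁) := by gcongr
      _ ≤ 3 * (n * Real.exp (2 * M₁)) := by
          have : 0 ≤ n * Real.exp (2 * (M₁ : ℝ)) := by positivity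
          linarith
      _ ≤ Real.exp 2 * (n * Real.exp (2 * M₁)) := by gcongr
      _ = Real.exp 2 * Real.exp (2 * M₁) * n := by ring
      _ = Real.exp (2 + 2 * M₁ + Real.log n) := by rw [Real.exp_add, Real.exp_add, hexplog]
      _ ≤ _ := Real.exp_le_exp.2 (by nlinarith)
  calc _ ≤ n * (Real.exp (2 * M₁) * p) + (M₁ * n + 1) * (2 * p) := by gcongr
    _ = p * (n * Real.exp (2 * M₁) + 2 * (M₁ * n + 1)) := by ring
    _ ≤ _ := mul_le_mul_of_nonneg_left hpoly hp.le
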